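/- Fix integers n ≥ 1, k₁, k₂ ≥ 0, N ≥ 0 and a real C > 0. Define φ̃_{k₁,k₂}(R, ξ) = e^{R·r(−ξ)} (πξ)^{n+k₁} cos(πξ)^{k₁} (1 − ξ)^{n+k₁+k₂} / sin(πξ)^{n+k₁} (extended analytically with value 1 at (R, ξ) = (0, 0)), and for δ > 0, κ ≥ 0 set H_{k₁,k₂}(δ, κ) = ∫_{−π}^{π} e^{κ·cos(s)} e^{−i(n+k₁−1)s} φ̃_{k₁,k₂}(δκ/2, δe^{is}) ds. Then there exist K > 0 and δ₀ > 0 such that for all δ ∈ (0, δ₀] and all κ ∈ [0, C], |H_{k₁,k₂}(δ, κ) − 2π Σ_{α ∈ ℕ², α₁+α₂ ≤ N} I_{n+k₁−1−α₂}(κ) · (∂_R^{α₁}∂_ξ^{α₂} φ̃_{k₁,k₂}(0, 0) / (α₁! α₂!)) · (κ/2)^{α₁} · δ^{α₁+α₂}| ≤ K·δ^{N+1}. -/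

import Mathlib

open Real Complex MeasureTheory intervalIntegral

/-- r(λ) = 1 + 1/λ − π(1 + λ)cot(πλ) for λ ∉ ℤ, extended by r(0) = 0. -/
noncomputable def rfun (z : ℂ) : ℂ :=
  if z = 0 then 0
  else 1 + 1 / z - (π : ℂ) * (1 + z) * (Complex.cos ((π : ℂ) * z) / Complex.sin ((π : ℂ) * z))

/-- φ̃_{k₁,k₂}(R, ξ) = e^{R·r(−ξ)} (πξ)^{n+k₁} cos(πξ)^{k₁} (1 − ξ)^{n+k₁+k₂}/sin(πξ)^{n+k₁},
analytically extended (with value 1) at ξ = 0. -/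
noncomputable def tphi (n k₁ k₂ : ℕ) (R ξ : ℂ) : ℂ :=
  if ξ = 0 then 1
  else Complex.exp (R * rfun (-ξ)) *
    (((π : ℂ) * ξ) ^ (n + k₁) * Complex.cos ((π : ℂ) * ξ) ^ k₁ * (1 - ξ) ^ (n + k₁ + k₂)
      / Complex.sin ((π : ℂ) * ξ) ^ (n + k₁))

/-- H_{k₁,k₂}(δ, κ) = ∫_{−π}^{π} e^{κcos s} e^{−i(n+k₁−1)s} φ̃_{k₁,k₂}(δκ/2, δe^{is}) ds. -/
noncomputable def Hfun (n k₁ k₂ : ℕ) (δ κ : ℝ) : ℂ :=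
  ∫ s in (-π)..π,
    Complex.exp (((κ * Real.cos s : ℝ) : ℂ)) *
      Complex.exp (-Complex.I * ((n + k₁ - 1 : ℕ) : ℂ) * (s : ℂ)) *
      tphi n k₁ k₂ ((δ * κ / 2 : ℝ) : ℂ) ((δ : ℂ) * Complex.exp (Complex.I * (s : ℂ)))

/-- Modified Bessel function I_ν, ν ∈ ℤ; terms with Γ at a nonpositive integer vanish
(`Real.Gamma` is 0 there, so the corresponding term is a division by zero, i.e. 0). -/
noncomputable def besselI (ν : ℤ) (s : ℝ) : ℝ :=
  ∑' k : ℕ, s ^ (2 * (k : ℤ) + ν) /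
    ((2 : ℝ) ^ (2 * (k : ℤ) + ν) * (Nat.factorial k) * Real.Gamma ((k : ℝ) + (ν : ℝ) + 1))

/-- The mixed partial derivative ∂_R^{a}∂_ξ^{b} φ̃_{k₁,k₂}(0,0) of the analytic extension. -/
noncomputable def tphiDeriv (n k₁ k₂ : ℕ) (a b : ℕ) : ℂ :=
  iteratedDeriv b (fun ξ : ℂ => iteratedDeriv a (fun R : ℂ => tphi n k₁ k₂ R ξ) 0) 0


theorem hasSum_intervalIntegral_of_norm_le {F : ℕ → ℝ → ℂ} {f : ℝ → ℂ} {u : ℕ → ℝ} {a b : ℝ}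
    (hF : ∀ k, Continuous (F k)) (hle : ∀ k s, ‖F k s‖ ≤ u k) (hu : Summable u)
    (hf : ∀ s, HasSum (fun k => F k s) (f s)) :
    HasSum (fun k => ∫ s in a..b, F k s) (∫ s in a..b, f s) := by
  refine intervalIntegral.hasSum_integral_of_dominated_convergence (fun k _ => u k)
    (fun k => (hF k).aestronglyMeasurable) ?_ ?_ ?_ ?_
  · exact fun k => Filter.Eventually.of_forall fun s _ => hle k s
  · exact Filter.Eventually.of_forall fun s _ => hu
  · exact intervalIntegrable_const
  · exact Filter.Eventually.of_forall fun s _ => hf s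

theorem integral_cexp_int_mul (m : ℤ) :
    ∫ s in (-π)..π, Complex.exp (Complex.I * (m : ℂ) * (s : ℂ)) =
      if m = 0 then 2 * (π : ℂ) else 0 := by
  split_ifs with h
  · subst h
    simp
    ring
  · have hc : Complex.I * (m : ℂ) ≠ 0 := mul_ne_zero Complex.I_ne_zero (by exact_mod_cast h)
    rw [integral_exp_mul_complex hc, div_eq_zero_iff]
    left
    rw [sub_eq_zero, Complex.exp_eq_exp_iff_exists_int]
    exact ⟨m, by push_cast; ring⟩

theorem hasSum_pow_div_factorial_cexp (z : ℂ) :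
    HasSum (fun k : ℕ => z ^ k / (k.factorial : ℂ)) (Complex.exp z) := by
  rw [Complex.exp_eq_exp_ℂ]
  exact NormedSpace.expSeries_div_hasSum_exp z

theorem integral_cexp_mul_cexp_mul_cexp (a : ℂ) (m : ℤ) :
    ∫ s in (-π)..π, Complex.exp (a * Complex.exp (Complex.I * (s : ℂ))) *
        Complex.exp (-Complex.I * (m : ℂ) * (s : ℂ)) =
      2 * (π : ℂ) * if 0 ≤ m then a ^ m.toNat / (m.toNat.factorial : ℂ) else 0 := by
  have key : HasSum (fun j : ℕ => ∫ s in (-π)..π, a ^ j / (j.factorial : ℂ) *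
      Complex.exp (Complex.I * (((j : ℤ) - m : ℤ) : ℂ) * (s : ℂ)))
      (∫ s in (-π)..π, Complex.exp (a * Complex.exp (Complex.I * (s : ℂ))) *
        Complex.exp (-Complex.I * (m : ℂ) * (s : ℂ))) := by
    refine hasSum_intervalIntegral_of_norm_le (u := fun j => ‖a‖ ^ j / j.factorial)
      (fun j => by fun_prop) (fun j s => ?_) (Real.summable_pow_div_factorial _) (fun s => ?_)
    · rw [norm_mul, norm_div, norm_pow, Complex.norm_natCast,
        show Complex.I * (((j : ℤ) - m : ℤ) : ℂ) * (s : ℂ) =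
          ((((j : ℤ) - m : ℤ) * s : ℝ) : ℂ) * Complex.I by push_cast; ring,
        Complex.norm_exp_ofReal_mul_I, mul_one]
    · refine ((hasSum_pow_div_factorial_cexp (a * Complex.exp (Complex.I * (s : ℂ)))).mul_right
        (Complex.exp (-Complex.I * (m : ℂ) * (s : ℂ)))).congr_fun fun j => ?_
      rw [mul_pow, ← Complex.exp_nat_mul, mul_div_right_comm, mul_assoc (_ / _), ← Complex.exp_add]
      congr 2
      push_cast
      ring
  refine key.unique ?_
  simp only [intervalIntegral.integral_const_mul, integral_cexp_int_mul]
  split_ifs with h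
  · lift m to ℕ using h
    convert hasSum_single m ?_ using 1
    · simp
      ring
    · intro j hj
      rw [if_neg (by omega), mul_zero]
  · convert hasSum_zero using 2 with j
    · rw [if_neg (by omega), mul_zero]
    · simp

theorem integral_cexp_mul_cos_mul_cexp (ν : ℤ) (κ : ℝ) :
    ∫ s in (-π)..π, Complex.exp (((κ * Real.cos s : ℝ) : ℂ)) *
        Complex.exp (-Complex.I * (ν : ℂ) * (s : ℂ)) = 2 * (π : ℂ) * (besselI ν κ : ℂ) := by
  have key : HasSum (fun k : ℕ => ∫ s in (-π)..π, (κ / 2 : ℂ) ^ k / (k.factorial : ℂ) *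
      (Complex.exp ((κ / 2 : ℂ) * Complex.exp (Complex.I * (s : ℂ))) *
        Complex.exp (-Complex.I * ((ν + k : ℤ) : ℂ) * (s : ℂ))))
      (∫ s in (-π)..π, Complex.exp (((κ * Real.cos s : ℝ) : ℂ)) *
        Complex.exp (-Complex.I * (ν : ℂ) * (s : ℂ))) := by
    refine hasSum_intervalIntegral_of_norm_le
      (u := fun k => ‖(κ / 2 : ℂ)‖ ^ k / k.factorial * Real.exp ‖(κ / 2 : ℂ)‖)
      (fun k => by fun_prop) (fun k s => ?_)
      ((Real.summable_pow_div_factorial _).mul_right _) (fun s => ?_)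
    · rw [norm_mul, norm_div, norm_pow, Complex.norm_natCast, norm_mul,
        show -Complex.I * ((ν + k : ℤ) : ℂ) * (s : ℂ) =
          ((-(ν + k : ℤ) * s : ℝ) : ℂ) * Complex.I by push_cast; ring,
        Complex.norm_exp_ofReal_mul_I, mul_one]
      gcongr
      refine (Complex.norm_exp_le_exp_norm _).trans_eq ?_
      rw [norm_mul, mul_comm Complex.I, Complex.norm_exp_ofReal_mul_I, mul_one]
    · have h := (hasSum_pow_div_factorial_cexp
        ((κ / 2 : ℂ) * Complex.exp (-Complex.I * (s : ℂ)))).mul_right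
        (Complex.exp ((κ / 2 : ℂ) * Complex.exp (Complex.I * (s : ℂ))) *
          Complex.exp (-Complex.I * (ν : ℂ) * (s : ℂ)))
      have hcos : Complex.exp ((κ / 2 : ℂ) * Complex.exp (-Complex.I * (s : ℂ))) *
          (Complex.exp ((κ / 2 : ℂ) * Complex.exp (Complex.I * (s : ℂ))) *
            Complex.exp (-Complex.I * (ν : ℂ) * (s : ℂ))) =
          Complex.exp (((κ * Real.cos s : ℝ) : ℂ)) *
            Complex.exp (-Complex.I * (ν : ℂ) * (s : ℂ)) := by
        rw [← mul_assoc, ← Complex.exp_add]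
        congr 2
        push_cast
        rw [Complex.cos]
        ring_nf
      rw [hcos] at h
      refine h.congr_fun fun k => ?_
      rw [mul_pow, ← Complex.exp_nat_mul]
      rw [show -Complex.I * ((ν + k : ℤ) : ℂ) * (s : ℂ) =
          (k : ℂ) * (-Complex.I * (s : ℂ)) + -Complex.I * (ν : ℂ) * (s : ℂ) by push_cast; ring,
        Complex.exp_add]
      ring
  rw [← key.tsum_eq, besselI, Complex.ofReal_tsum, ← tsum_mul_left]
  refine tsum_congr fun k => ?_
  rw [intervalIntegral.integral_const_mul, integral_cexp_mul_cexp_mul_cexp]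
  split_ifs with h
  · obtain ⟨m, hm⟩ := Int.eq_ofNat_of_zero_le h
    obtain rfl : ν = m - k := by omega
    have h1 : (k : ℝ) + ((m - k : ℤ) : ℝ) + 1 = (m : ℝ) + 1 := by push_cast; ring
    have h2 : 2 * (k : ℤ) + (m - k) = ((k + m : ℕ) : ℤ) := by push_cast; ring
    rw [h1, h2, Real.Gamma_nat_eq_factorial, hm, zpow_natCast, zpow_natCast, Int.toNat_natCast]
    push_cast
    rw [mul_left_comm, div_mul_div_comm, ← pow_add, div_pow, div_div]
    ring
  · obtain ⟨m, hm⟩ := Int.eq_ofNat_of_zero_le (show 0 ≤ -(ν + k) - 1 by omega)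
    obtain rfl : ν = -m - 1 - k := by omega
    have h1 : (k : ℝ) + ((-m - 1 - k : ℤ) : ℝ) + 1 = -(m : ℝ) := by push_cast; ring
    rw [h1, Real.Gamma_neg_nat_eq_zero]
    simp

open Asymptotics Filter Topology

theorem AnalyticAt.isBigO_sub_taylor {f : ℂ → ℂ} (hf : AnalyticAt ℂ f 0) (M : ℕ) :
    (fun z => f z - ∑ b ∈ Finset.range M, iteratedDeriv b f 0 / (b.factorial : ℂ) * z ^ b)
      =O[𝓝 0] fun z => z ^ M := by
  have h := hf.hasFPowerSeriesAt.isBigO_sub_partialSum_pow M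
  simp only [zero_add, FormalMultilinearSeries.partialSum,
    FormalMultilinearSeries.ofScalars_apply_eq, smul_eq_mul, ← norm_pow] at h
  exact h.of_norm_right

/-- The entire function `sin (π z) / z`. -/
noncomputable def sinPiSlope : ℂ → ℂ := dslope (fun z => Complex.sin (π * z)) 0

theorem sinPiSlope_zero : sinPiSlope 0 = π := by
  have h : HasDerivAt (fun z : ℂ => Complex.sin (π * z)) (Complex.cos (π * 0) * (π * 1)) 0 :=
    ((hasDerivAt_id (0 : ℂ)).const_mul (π : ℂ)).csin
  rw [sinPiSlope, dslope_same, h.deriv]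
  simp

theorem sinPiSlope_of_ne {z : ℂ} (hz : z ≠ 0) : sinPiSlope z = Complex.sin (π * z) / z := by
  rw [sinPiSlope, dslope_of_ne _ hz, slope_def_field]
  simp

theorem differentiable_dslope {f : ℂ → ℂ} (hf : Differentiable ℂ f) (c : ℂ) :
    Differentiable ℂ (dslope f c) := by
  rw [← differentiableOn_univ] at hf ⊢
  exact (Complex.differentiableOn_dslope Filter.univ_mem).2 hf

theorem differentiable_sinPiSlope : Differentiable ℂ sinPiSlope :=
  differentiable_dslope (by fun_prop) 0

theorem sinPiSlope_neg (z : ℂ) : sinPiSlope (-z) = sinPiSlope z := by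
  rcases eq_or_ne z 0 with rfl | hz
  · simp
  · rw [sinPiSlope_of_ne hz, sinPiSlope_of_ne (neg_ne_zero.2 hz)]
    simp [neg_div_neg_eq]

theorem analyticAt_rfun : AnalyticAt ℂ rfun 0 := by
  set W : ℂ → ℂ := fun z => sinPiSlope z - π * Complex.cos (π * z) with hW
  have hWd : Differentiable ℂ W := differentiable_sinPiSlope.sub (by fun_prop)
  have hW0 : W 0 = 0 := by simp [hW, sinPiSlope_zero]
  have hWe : (fun z => W (-z)) = W := by
    ext z
    simp [hW, sinPiSlope_neg]
  have hW' : deriv W 0 = 0 := by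
    have h := deriv_comp_neg W 0
    rw [hWe, neg_zero] at h
    exact self_eq_neg.1 h
  have hS : AnalyticAt ℂ sinPiSlope 0 := differentiable_sinPiSlope.analyticAt 0
  have hS0 : sinPiSlope 0 ≠ 0 := by
    rw [sinPiSlope_zero]
    exact_mod_cast Real.pi_ne_zero
  have hmain : AnalyticAt ℂ (fun z => (1 + z) * dslope W 0 z / sinPiSlope z) 0 := by
    refine AnalyticAt.div (AnalyticAt.mul (by fun_prop) ?_) hS hS0
    exact (differentiable_dslope hWd 0).analyticAt 0
  refine hmain.congr ?_
  filter_upwards [hS.continuousAt.eventually_ne hS0] with z hz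
  rcases eq_or_ne z 0 with rfl | hz0
  · simp [rfun, hW']
  · rw [rfun, if_neg hz0, dslope_of_ne _ hz0, slope_def_field, hW0]
    rw [sinPiSlope_of_ne hz0] at hz
    have hs : Complex.sin (π * z) ≠ 0 := fun h => hz (by simp [h])
    simp only [hW, sinPiSlope_of_ne hz0]
    generalize Complex.sin (π * z) = x at hs
    generalize Complex.cos (π * z) = y
    field_simp
    ring

theorem tphi_eq (n k₁ k₂ : ℕ) (R ξ : ℂ) :
    tphi n k₁ k₂ R ξ = Complex.exp (R * rfun (-ξ)) * tphi n k₁ k₂ 0 ξ := by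
  unfold tphi
  split_ifs with h
  · simp [h, rfun]
  · simp

theorem analyticAt_tphi_zero (n k₁ k₂ : ℕ) : AnalyticAt ℂ (tphi n k₁ k₂ 0) 0 := by
  have hS : AnalyticAt ℂ sinPiSlope 0 := differentiable_sinPiSlope.analyticAt 0
  have hpi : (π : ℂ) ≠ 0 := by exact_mod_cast Real.pi_ne_zero
  have hS0 : sinPiSlope 0 ≠ 0 := by rwa [sinPiSlope_zero]
  have hc : AnalyticAt ℂ (fun z : ℂ => Complex.cos (π * z)) 0 :=
    (show Differentiable ℂ fun z : ℂ => Complex.cos (π * z) by fun_prop).analyticAt 0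
  have hmain : AnalyticAt ℂ (fun ξ => (π : ℂ) ^ (n + k₁) * Complex.cos (π * ξ) ^ k₁ *
      (1 - ξ) ^ (n + k₁ + k₂) / sinPiSlope ξ ^ (n + k₁)) 0 :=
    AnalyticAt.div (((analyticAt_const.mul (hc.pow _))).mul
      ((analyticAt_const.sub analyticAt_id).pow _)) (hS.pow _) (pow_ne_zero _ hS0)
  refine hmain.congr (Eventually.of_forall fun ξ => ?_)
  rcases eq_or_ne ξ 0 with rfl | h
  · simp [tphi, sinPiSlope_zero, hpi]
  · simp only [tphi, if_neg h, sinPiSlope_of_ne h, mul_pow, div_pow, zero_mul, Complex.exp_zero,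
      one_mul]
    field_simp

theorem iteratedDeriv_tphi (n k₁ k₂ a : ℕ) (ξ : ℂ) :
    iteratedDeriv a (fun R : ℂ => tphi n k₁ k₂ R ξ) 0 = rfun (-ξ) ^ a * tphi n k₁ k₂ 0 ξ := by
  have h : (fun R : ℂ => tphi n k₁ k₂ R ξ) =
      fun R : ℂ => Complex.exp (rfun (-ξ) * R) * tphi n k₁ k₂ 0 ξ := by
    ext R
    rw [tphi_eq, mul_comm R]
  rw [h, iteratedDeriv_mul_const_field, iteratedDeriv_cexp_const_mul]
  simp

theorem analyticAt_rfun_neg : AnalyticAt ℂ (fun ξ => rfun (-ξ)) 0 :=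
  AnalyticAt.fun_comp (g := rfun) (by simpa using analyticAt_rfun) analyticAt_id.neg

theorem isBigO_rfun_pow_mul_tphi (n k₁ k₂ a M : ℕ) :
    (fun ξ => rfun (-ξ) ^ a * tphi n k₁ k₂ 0 ξ -
      ∑ b ∈ Finset.range M, tphiDeriv n k₁ k₂ a b / (b.factorial : ℂ) * ξ ^ b)
      =O[𝓝 0] fun ξ => ξ ^ M := by
  have h := ((analyticAt_rfun_neg.pow a).mul (analyticAt_tphi_zero n k₁ k₂)).isBigO_sub_taylor M
  simp only [tphiDeriv, iteratedDeriv_tphi]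
  exact h

/-- Degree `N` Taylor polynomial of `tphi` at the origin. -/
noncomputable def tphiTaylor (n k₁ k₂ N : ℕ) (R ξ : ℂ) : ℂ :=
  ∑ α ∈ Finset.filter (fun α : ℕ × ℕ => α.1 + α.2 ≤ N)
      (Finset.range (N + 1) ×ˢ Finset.range (N + 1)),
    tphiDeriv n k₁ k₂ α.1 α.2 /
      (((Nat.factorial α.1 : ℕ) : ℂ) * ((Nat.factorial α.2 : ℕ) : ℂ)) * R ^ α.1 * ξ ^ α.2

theorem tphiTaylor_eq (n k₁ k₂ N : ℕ) (R ξ : ℂ) :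
    tphiTaylor n k₁ k₂ N R ξ = ∑ a ∈ Finset.range (N + 1), R ^ a / (a.factorial : ℂ) *
      ∑ b ∈ Finset.range (N + 1 - a), tphiDeriv n k₁ k₂ a b / (b.factorial : ℂ) * ξ ^ b := by
  rw [tphiTaylor, Finset.sum_filter, Finset.sum_product]
  refine Finset.sum_congr rfl fun a ha => ?_
  rw [← Finset.sum_filter, Finset.mul_sum]
  refine Finset.sum_congr ?_ fun b hb => ?_
  · ext b
    simp only [Finset.mem_filter, Finset.mem_range]
    omega
  · rw [div_mul_eq_div_div]
    ring

theorem isBigO_tphi_sub_tphiTaylor {X : Type*} {l : Filter X} (n k₁ k₂ N : ℕ) {δ : X → ℝ}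
    {R ξ : X → ℂ} (hδ : Tendsto δ l (𝓝 0)) (hR : R =O[l] δ) (hξ : ξ =O[l] δ) :
    (fun x => tphi n k₁ k₂ (R x) (ξ x) - tphiTaylor n k₁ k₂ N (R x) (ξ x))
      =O[l] fun x => δ x ^ (N + 1) := by
  have hξ0 : Tendsto ξ l (𝓝 0) := hξ.trans_tendsto hδ
  have hg : Tendsto (fun x => rfun (-(ξ x))) l (𝓝 (rfun (-0))) :=
    analyticAt_rfun_neg.continuousAt.tendsto.comp hξ0
  have hg1 : (fun x => rfun (-(ξ x))) =O[l] fun _ => (1 : ℝ) := hg.isBigO_one ℝ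
  have hh1 : (fun x => tphi n k₁ k₂ 0 (ξ x)) =O[l] fun _ => (1 : ℝ) :=
    ((analyticAt_tphi_zero n k₁ k₂).continuousAt.tendsto.comp hξ0).isBigO_one ℝ
  have hw : (fun x => R x * rfun (-(ξ x))) =O[l] δ := by simpa using hR.mul hg1
  have hexp := ((analyticAt_cexp (z := 0)).isBigO_sub_taylor (N + 1)).comp_tendsto
    (hw.trans_tendsto hδ)
  have hexp' := ((hexp.trans (hw.pow (N + 1))).mul hh1)
  have hsum : (fun x => ∑ a ∈ Finset.range (N + 1), R x ^ a / (a.factorial : ℂ) *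
      (rfun (-(ξ x)) ^ a * tphi n k₁ k₂ 0 (ξ x) - ∑ b ∈ Finset.range (N + 1 - a),
        tphiDeriv n k₁ k₂ a b / (b.factorial : ℂ) * ξ x ^ b)) =O[l] fun x => δ x ^ (N + 1) := by
    refine IsBigO.fun_sum fun a ha => ?_
    have h1 := ((isBigO_rfun_pow_mul_tphi n k₁ k₂ a (N + 1 - a)).comp_tendsto hξ0).trans
      (hξ.pow (N + 1 - a))
    have h2 : (fun x => R x ^ a / (a.factorial : ℂ)) =O[l] fun x => δ x ^ a := by
      simpa only [div_eq_inv_mul] using (hR.pow a).const_mul_left (a.factorial : ℂ)⁻¹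
    refine (h2.mul h1).congr_right fun x => ?_
    rw [← pow_add, Nat.add_sub_cancel' (Finset.mem_range.1 ha).le]
  refine (hexp'.add (hsum.congr_right fun _ => (mul_one _).symm)).congr' ?_ ?_
  · refine Eventually.of_forall fun x => ?_
    beta_reduce
    rw [tphiTaylor_eq, tphi_eq n k₁ k₂ (R x)]
    simp only [Function.comp, mul_sub, sub_mul, Finset.sum_sub_distrib, Finset.sum_mul,
      iteratedDeriv_eq_iterate, Complex.iter_deriv_exp, Complex.exp_zero, mul_pow]
    rw [← add_sub_assoc]
    congr 1
    rw [sub_add]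
    simp only [sub_eq_self, sub_eq_zero]
    refine Finset.sum_congr rfl fun a _ => ?_
    ring
  · simp

theorem exists_continuousOn_tphi (n k₁ k₂ : ℕ) :
    ∃ r > 0, ∀ R, ContinuousOn (tphi n k₁ k₂ R) (Metric.ball 0 r) := by
  obtain ⟨r, hr, h⟩ := Metric.eventually_nhds_iff_ball.1
    (analyticAt_rfun_neg.eventually_analyticAt.and
      (analyticAt_tphi_zero n k₁ k₂).eventually_analyticAt)
  refine ⟨r, hr, fun R ξ hξ => ContinuousAt.continuousWithinAt ?_⟩
  rw [show tphi n k₁ k₂ R = fun ξ => Complex.exp (R * rfun (-ξ)) * tphi n k₁ k₂ 0 ξ from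
    funext fun ξ => tphi_eq n k₁ k₂ R ξ]
  have h1 := (h ξ hξ).1.continuousAt
  have h2 := (h ξ hξ).2.continuousAt
  fun_prop

theorem norm_ofReal_mul_cexp_I_mul {δ : ℝ} (hδ : 0 ≤ δ) (s : ℝ) :
    ‖(δ : ℂ) * Complex.exp (Complex.I * (s : ℂ))‖ = δ := by
  rw [norm_mul, mul_comm Complex.I, Complex.norm_exp_ofReal_mul_I, mul_one,
    Complex.norm_of_nonneg hδ]

theorem exists_norm_tphi_sub_tphiTaylor_le (n k₁ k₂ N : ℕ) (C : ℝ) :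
    ∃ K > 0, ∃ ε > 0, ∀ δ ∈ Set.Ioo (0 : ℝ) ε, ∀ κ ∈ Set.Icc (0 : ℝ) C, ∀ s : ℝ,
      ‖tphi n k₁ k₂ ((δ * κ / 2 : ℝ) : ℂ) ((δ : ℂ) * Complex.exp (Complex.I * (s : ℂ))) -
        tphiTaylor n k₁ k₂ N ((δ * κ / 2 : ℝ) : ℂ) ((δ : ℂ) * Complex.exp (Complex.I * (s : ℂ)))‖
        ≤ K * δ ^ (N + 1) := by
  let S : Set (ℝ × ℝ × ℝ) := {x | 0 < x.1 ∧ x.2.1 ∈ Set.Icc (0 : ℝ) C}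
  let l : Filter (ℝ × ℝ × ℝ) := comap Prod.fst (𝓝 0) ⊓ 𝓟 S
  have hS : ∀ᶠ x in l, x ∈ S := mem_inf_of_right (mem_principal_self S)
  have hδ : Tendsto (fun x : ℝ × ℝ × ℝ => x.1) l (𝓝 0) := tendsto_comap.mono_left inf_le_left
  have hR : (fun x : ℝ × ℝ × ℝ => ((x.1 * x.2.1 / 2 : ℝ) : ℂ)) =O[l] fun x => x.1 := by
    refine IsBigO.of_bound C ?_
    filter_upwards [hS] with x hx
    obtain ⟨h1, h2, h3⟩ := hx
    rw [Complex.norm_of_nonneg (by positivity), Real.norm_of_nonneg h1.le]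
    nlinarith [mul_nonneg h1.le h2]
  have hξ : (fun x : ℝ × ℝ × ℝ => (x.1 : ℂ) * Complex.exp (Complex.I * (x.2.2 : ℂ)))
      =O[l] fun x => x.1 := by
    refine IsBigO.of_bound 1 ?_
    filter_upwards [hS] with x hx
    rw [norm_ofReal_mul_cexp_I_mul hx.1.le, one_mul]
    exact le_abs_self _
  obtain ⟨K, hK, h⟩ := (isBigO_tphi_sub_tphiTaylor n k₁ k₂ N hδ hR hξ).exists_pos
  have h' := h.bound
  rw [eventually_inf_principal, eventually_comap, Metric.eventually_nhds_iff] at h'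
  obtain ⟨ε, hε, h'⟩ := h'
  refine ⟨K, hK, ε, hε, fun δ hδ κ hκ s => ?_⟩
  have := h' (y := δ) (by simpa [abs_of_pos hδ.1] using hδ.2) (δ, κ, s) rfl ⟨hδ.1, hκ⟩
  rwa [Real.norm_of_nonneg (pow_nonneg hδ.1.le _)] at this

theorem continuous_tphiTaylor (n k₁ k₂ N : ℕ) (R : ℂ) :
    Continuous (tphiTaylor n k₁ k₂ N R) := by
  unfold tphiTaylor
  fun_prop

theorem integral_mul_tphiTaylor (n k₁ k₂ N : ℕ) (ν : ℤ) (δ κ : ℝ) :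
    ∫ s in (-π)..π, Complex.exp (((κ * Real.cos s : ℝ) : ℂ)) *
        Complex.exp (-Complex.I * (ν : ℂ) * (s : ℂ)) *
        tphiTaylor n k₁ k₂ N ((δ * κ / 2 : ℝ) : ℂ) ((δ : ℂ) * Complex.exp (Complex.I * (s : ℂ))) =
      2 * (π : ℂ) *
        ∑ α ∈ Finset.filter (fun α : ℕ × ℕ => α.1 + α.2 ≤ N)
            (Finset.range (N + 1) ×ˢ Finset.range (N + 1)),
          ((besselI (ν - (α.2 : ℤ)) κ : ℝ) : ℂ) *
            (tphiDeriv n k₁ k₂ α.1 α.2 /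
              (((Nat.factorial α.1 : ℕ) : ℂ) * ((Nat.factorial α.2 : ℕ) : ℂ))) *
            ((κ / 2 : ℝ) : ℂ) ^ α.1 * ((δ : ℝ) : ℂ) ^ (α.1 + α.2) := by
  simp only [tphiTaylor, Finset.mul_sum]
  rw [intervalIntegral.integral_finsetSum
    fun α _ => Continuous.intervalIntegrable (by fun_prop) _ _]
  refine Finset.sum_congr rfl fun α _ => ?_
  rw [← mul_assoc, ← mul_assoc, ← mul_assoc, ← integral_cexp_mul_cos_mul_cexp, mul_assoc,
    mul_assoc, ← intervalIntegral.integral_mul_const]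
  refine intervalIntegral.integral_congr fun s _ => ?_
  rw [show -Complex.I * ((ν - (α.2 : ℤ) : ℤ) : ℂ) * (s : ℂ) =
    -Complex.I * (ν : ℂ) * (s : ℂ) + (α.2 : ℂ) * (Complex.I * (s : ℂ)) by push_cast; ring,
    Complex.exp_add, Complex.exp_nat_mul]
  push_cast
  ring

/-- Expansion of H_{k₁,k₂}(δ, κ) in powers of δ, uniformly for κ ∈ [0, C]. -/
theorem Hfun_expansion (n k₁ k₂ N : ℕ) (hn : 1 ≤ n) (C : ℝ) (hC : 0 < C) :
    ∃ K : ℝ, 0 < K ∧ ∃ δ₀ : ℝ, 0 < δ₀ ∧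
      ∀ δ : ℝ, δ ∈ Set.Ioc (0 : ℝ) δ₀ → ∀ κ ∈ Set.Icc (0 : ℝ) C,
        ‖Hfun n k₁ k₂ δ κ -
          2 * (π : ℂ) *
            ∑ α ∈ Finset.filter (fun α : ℕ × ℕ => α.1 + α.2 ≤ N)
                (Finset.range (N + 1) ×ˢ Finset.range (N + 1)),
              ((besselI ((n : ℤ) + (k₁ : ℤ) - 1 - (α.2 : ℤ)) κ : ℝ) : ℂ) *
                (tphiDeriv n k₁ k₂ α.1 α.2 /
                  (((Nat.factorial α.1 : ℕ) : ℂ) * ((Nat.factorial α.2 : ℕ) : ℂ))) *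
                ((κ / 2 : ℝ) : ℂ) ^ α.1 * ((δ : ℝ) : ℂ) ^ (α.1 + α.2)‖
          ≤ K * δ ^ (N + 1) := by
  obtain ⟨r, hr, hcont⟩ := exists_continuousOn_tphi n k₁ k₂
  obtain ⟨K, hK, ε, hε, hle⟩ := exists_norm_tphi_sub_tphiTaylor_le n k₁ k₂ N C
  refine ⟨Real.exp C * K * (2 * π), by positivity, min r ε / 2, by positivity,
    fun δ hδ κ hκ => ?_⟩
  obtain ⟨hδ0, hδ1⟩ := hδ
  have hmin : 0 < min r ε := lt_min hr hε
  have hδr : δ < r := by linarith [min_le_left r ε]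
  have hδε : δ < ε := by linarith [min_le_right r ε]
  have hν : ((n + k₁ - 1 : ℕ) : ℤ) = (n : ℤ) + (k₁ : ℤ) - 1 := by omega
  have hν' : ((n + k₁ - 1 : ℕ) : ℂ) = (((n : ℤ) + (k₁ : ℤ) - 1 : ℤ) : ℂ) := by
    rw [← hν, Int.cast_natCast]
  have hphi : Continuous fun s : ℝ =>
      tphi n k₁ k₂ ((δ * κ / 2 : ℝ) : ℂ) ((δ : ℂ) * Complex.exp (Complex.I * (s : ℂ))) := by
    refine (hcont _).comp_continuous (by fun_prop) fun s => ?_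
    rwa [mem_ball_zero_iff, norm_ofReal_mul_cexp_I_mul hδ0.le]
  have hT : Continuous fun s : ℝ => tphiTaylor n k₁ k₂ N ((δ * κ / 2 : ℝ) : ℂ)
      ((δ : ℂ) * Complex.exp (Complex.I * (s : ℂ))) :=
    (continuous_tphiTaylor n k₁ k₂ N _).comp (by fun_prop)
  rw [← integral_mul_tphiTaylor, Hfun, hν', ← intervalIntegral.integral_sub
    (Continuous.intervalIntegrable (by fun_prop) _ _)
    (Continuous.intervalIntegrable (by fun_prop) _ _)]
  refine (intervalIntegral.norm_integral_le_of_norm_le_const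
    (C := Real.exp C * (K * δ ^ (N + 1))) fun s _ => ?_).trans_eq ?_
  · rw [← mul_sub, norm_mul, norm_mul,
      show -Complex.I * (((n : ℤ) + (k₁ : ℤ) - 1 : ℤ) : ℂ) * (s : ℂ) =
        ((-((n : ℤ) + (k₁ : ℤ) - 1 : ℤ) * s : ℝ) : ℂ) * Complex.I by push_cast; ring,
      Complex.norm_exp_ofReal_mul_I, mul_one, Complex.norm_exp_ofReal]
    gcongr
    · nlinarith [hκ.1, hκ.2, Real.cos_le_one s]
    · exact hle δ ⟨hδ0, hδε⟩ κ hκ s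
  · rw [show π - -π = 2 * π by ring, abs_of_pos (by positivity)]
    ring
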